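/- arXiv:1308.1362 — 3 statements merged into one kernel-verified Lean document; each statement's English description precedes it below -/
import Mathlib

section
/- Suppose F : ℝⁿ → ℝⁿ is differentiable, its derivative F' is Lipschitz continuous with Lipschitz constant γ (in the operator norm), F(u*) = 0 for some u* ∈ ℝⁿ, and the linear map F'(u*) is invertible. Then there exist constants K̄ > 0, δ > 0, and δ₁ > 0 such that: for every u ∈ ℝⁿ with ‖u − u*‖ < δ, every linear map Δ : ℝⁿ → ℝⁿ with ‖Δ‖ < δ₁, and every vector ε ∈ ℝⁿ, the linear map F'(u) + Δ is invertible, and the updated point u⁺ = u − (F'(u) + Δ)⁻¹ (F(u) + ε) satisfies ‖u* − u⁺‖ ≤ K̄ ( ‖u* − u‖² + ‖Δ‖ · ‖u* − u‖ + ‖ε‖ ). -/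
open Matrix

/-- First-order Taylor estimate for a function with Lipschitz derivative. -/
theorem norm_sub_sub_fderiv_le_of_lipschitzWith {E G : Type*} [NormedAddCommGroup E]
    [NormedSpace ℝ E] [NormedAddCommGroup G] [NormedSpace ℝ G] {f : E → G} {f' : E → E →L[ℝ] G}
    (hf : ∀ x, HasFDerivAt f (f' x) x) {γ : NNReal} (hLip : LipschitzWith γ f') (x y : E) :
    ‖f y - f x - f' x (y - x)‖ ≤ γ * ‖y - x‖ ^ 2 := by
  have h := (convex_closedBall x ‖y - x‖).norm_image_sub_le_of_norm_hasFDerivWithin_le'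
    (f := f) (f' := f') (φ := f' x) (C := γ * ‖y - x‖) (x := x) (y := y)
    (fun z _ => (hf z).hasFDerivWithinAt)
    (fun z hz => by
      have hz' : ‖z - x‖ ≤ ‖y - x‖ := by simpa [dist_eq_norm] using hz
      exact (hLip.norm_sub_le z x).trans (by gcongr))
    (Metric.mem_closedBall_self (norm_nonneg _)) (by simp [dist_eq_norm])
  linarith

/-- Near a unit `a`, elements are units and their inverses are uniformly bounded. -/
theorem exists_ball_isUnit_and_norm_inverse_le {R : Type*} [NormedRing R] [HasSummableGeomSeries R]
    {a : R} (ha : IsUnit a) :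
    ∃ M r : ℝ, 0 < M ∧ 0 < r ∧ ∀ b : R, ‖b - a‖ < r → IsUnit b ∧ ‖Ring.inverse b‖ ≤ M := by
  obtain ⟨x, rfl⟩ := ha
  have hb : ∀ᶠ b in nhds (x : R), ‖Ring.inverse b‖ < ‖Ring.inverse (x : R)‖ + 1 :=
    (NormedRing.inverse_continuousAt x).norm.eventually_lt_const (lt_add_one _)
  obtain ⟨r, hr, h⟩ := Metric.eventually_nhds_iff.1 (Filter.Eventually.and (Units.nhds x) hb)
  refine ⟨‖Ring.inverse (x : R)‖ + 1, r, by positivity, hr, fun b hbr => ?_⟩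
  have hbx := h (y := b) (by rwa [dist_eq_norm])
  exact ⟨hbx.1, hbx.2.le⟩

/-- the inexact-Newton error lemma. If `F` is differentiable with
Lipschitz derivative, `F(u*) = 0`, and `F'(u*)` is invertible, then there exist
`K̄, δ, δ₁ > 0` such that for every `u` with `‖u − u*‖ < δ`, every perturbation
`Δ` with `‖Δ‖ < δ₁`, and every `ε`, the map `F'(u) + Δ` is invertible and the
update `u⁺ = u − (F'(u) + Δ)⁻¹ (F(u) + ε)` satisfies
`‖u* − u⁺‖ ≤ K̄ (‖u* − u‖² + ‖Δ‖ ‖u* − u‖ + ‖ε‖)`. -/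
theorem inexact_newton_step_error
    (n : ℕ)
    (F : EuclideanSpace ℝ (Fin n) → EuclideanSpace ℝ (Fin n))
    (F' : EuclideanSpace ℝ (Fin n) →
      (EuclideanSpace ℝ (Fin n) →L[ℝ] EuclideanSpace ℝ (Fin n)))
    (hF : ∀ u, HasFDerivAt F (F' u) u)
    (γ : NNReal) (hLip : LipschitzWith γ F')
    (ustar : EuclideanSpace ℝ (Fin n))
    (hroot : F ustar = 0)
    (hinv : IsUnit (F' ustar)) :
    ∃ K δ δ₁ : ℝ, 0 < K ∧ 0 < δ ∧ 0 < δ₁ ∧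
      ∀ u : EuclideanSpace ℝ (Fin n), ‖u - ustar‖ < δ →
      ∀ Δ : EuclideanSpace ℝ (Fin n) →L[ℝ] EuclideanSpace ℝ (Fin n), ‖Δ‖ < δ₁ →
      ∀ ε : EuclideanSpace ℝ (Fin n),
        IsUnit (F' u + Δ) ∧
        ‖ustar - (u - Ring.inverse (F' u + Δ) (F u + ε))‖ ≤
          K * (‖ustar - u‖ ^ 2 + ‖Δ‖ * ‖ustar - u‖ + ‖ε‖) := by
  obtain ⟨M, r, hM, hr, hball⟩ := exists_ball_isUnit_and_norm_inverse_le hinv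
  have hγ : (0 : ℝ) ≤ γ := γ.coe_nonneg
  refine ⟨M * (γ + 1), r / 2 / (γ + 1), r / 2, by positivity, by positivity, by positivity,
    fun u hu Δ hΔ ε => ?_⟩
  have hnear : ‖F' u + Δ - F' ustar‖ < r := by
    have h₁ : ‖F' u - F' ustar‖ ≤ γ * ‖u - ustar‖ := hLip.norm_sub_le u ustar
    have h₂ : ‖u - ustar‖ * (γ + 1) < r / 2 := (lt_div_iff₀ (by positivity)).1 hu
    have h₃ : ‖F' u + Δ - F' ustar‖ ≤ ‖F' u - F' ustar‖ + ‖Δ‖ := by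
      rw [add_sub_right_comm]
      exact norm_add_le _ _
    nlinarith [norm_nonneg (u - ustar)]
  obtain ⟨hA, hAinv⟩ := hball _ hnear
  refine ⟨hA, ?_⟩
  have hcancel : Ring.inverse (F' u + Δ) ((F' u + Δ) (ustar - u)) = ustar - u :=
    DFunLike.congr_fun (Ring.inverse_mul_cancel _ hA) (ustar - u)
  have herror : ustar - (u - Ring.inverse (F' u + Δ) (F u + ε)) =
      Ring.inverse (F' u + Δ)
        (-(F ustar - F u - F' u (ustar - u)) + Δ (ustar - u) + ε) := by
    have hsplit : -(F ustar - F u - F' u (ustar - u)) + Δ (ustar - u) + ε =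
        (F' u + Δ) (ustar - u) + (F u + ε) := by
      rw [hroot, _root_.add_apply]
      abel
    rw [hsplit, map_add _ ((F' u + Δ) (ustar - u)), hcancel]
    abel
  have htaylor := norm_sub_sub_fderiv_le_of_lipschitzWith hF hLip u ustar
  have hresidual : ‖-(F ustar - F u - F' u (ustar - u)) + Δ (ustar - u) + ε‖ ≤
      γ * ‖ustar - u‖ ^ 2 + ‖Δ‖ * ‖ustar - u‖ + ‖ε‖ := by
    refine norm_add₃_le.trans ?_
    rw [norm_neg]
    gcongr
    exact Δ.le_opNorm _
  rw [herror, mul_assoc]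
  refine (ContinuousLinearMap.le_of_opNorm_le _ hAinv _).trans ?_
  gcongr
  have hΔu : 0 ≤ ‖Δ‖ * ‖ustar - u‖ := by positivity
  nlinarith [mul_nonneg hγ hΔu, mul_nonneg hγ (norm_nonneg ε), sq_nonneg ‖ustar - u‖]
end

section
/- Suppose F : ℝⁿ → ℝⁿ is differentiable, its derivative F' is Lipschitz continuous with Lipschitz constant γ (in the operator norm), F(u*) = 0 for some u* ∈ ℝⁿ, and F'(u*) is invertible. Then there exist constants K_C > 0 and δ > 0 such that for every initial point u(0) = u₀ with ‖u₀ − u*‖ < δ, the chord iteration u(j+1) = u(j) − F'(u₀)⁻¹ F(u(j)) is well-defined for all j (in particular F'(u₀) is invertible and all iterates remain in the ball of radius δ around u*), converges to u*, and the errors e(j) := u* − u(j) satisfy ‖e(j+1)‖ ≤ K_C ‖e(0)‖ ‖e(j)‖ for all j ≥ 0. -/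
/-- One step of the chord iteration with Jacobian frozen at `u₀` contracts the distance to a root
by a factor proportional to the initial error. -/
theorem norm_chord_step_sub_root_le {E : Type*} [NormedAddCommGroup E] [NormedSpace ℝ E]
    {F : E → E} {F' : E → E →L[ℝ] E} (hF : ∀ u, HasFDerivAt F (F' u) u)
    {γ : NNReal} (hLip : LipschitzWith γ F') {a u₀ x : E} (hroot : F a = 0)
    (hu₀ : IsUnit (F' u₀)) (hx : ‖x - a‖ ≤ ‖u₀ - a‖) :
    ‖x - Ring.inverse (F' u₀) (F x) - a‖ ≤
      ‖Ring.inverse (F' u₀)‖ * (2 * γ * ‖u₀ - a‖) * ‖x - a‖ := by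
  have hbound : ∀ y ∈ Metric.closedBall a ‖u₀ - a‖, ‖F' y - F' u₀‖ ≤ 2 * γ * ‖u₀ - a‖ := by
    intro y hy
    rw [mem_closedBall_iff_norm] at hy
    have hyu : ‖y - u₀‖ ≤ 2 * ‖u₀ - a‖ := by
      have := norm_sub_le_norm_sub_add_norm_sub y a u₀
      rw [norm_sub_rev a u₀] at this
      linarith
    calc ‖F' y - F' u₀‖ ≤ γ * ‖y - u₀‖ := hLip.norm_sub_le y u₀
      _ ≤ γ * (2 * ‖u₀ - a‖) := by gcongr
      _ = 2 * γ * ‖u₀ - a‖ := by ring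
  have hmv : ‖F x - F a - F' u₀ (x - a)‖ ≤ 2 * γ * ‖u₀ - a‖ * ‖x - a‖ :=
    (convex_closedBall a ‖u₀ - a‖).norm_image_sub_le_of_norm_hasFDerivWithin_le'
      (fun y _ => (hF y).hasFDerivWithinAt) hbound
      (Metric.mem_closedBall_self (norm_nonneg _)) (mem_closedBall_iff_norm.2 hx)
  have hcancel : Ring.inverse (F' u₀) (F' u₀ (x - a)) = x - a :=
    DFunLike.congr_fun (Ring.inverse_mul_cancel _ hu₀) (x - a)
  have hstep : x - Ring.inverse (F' u₀) (F x) - a =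
      -Ring.inverse (F' u₀) (F x - F a - F' u₀ (x - a)) := by
    rw [hroot, sub_zero, map_sub, hcancel]
    abel
  rw [hstep, norm_neg, mul_assoc]
  exact (ContinuousLinearMap.le_opNorm _ _).trans (by gcongr)

/-- local linear convergence of the chord iteration. If `F` is
differentiable with Lipschitz derivative, `F(u*) = 0`, and `F'(u*)` is
invertible, then there are `K_C, δ > 0` such that for every starting point `u₀`
with `‖u₀ − u*‖ < δ`, the chord iteration `u(j+1) = u(j) − F'(u₀)⁻¹ F(u(j))` is
well-defined (in particular `F'(u₀)` is invertible, and all iterates stay in the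
`δ`-ball around `u*`), converges to `u*`, and satisfies
`‖e(j+1)‖ ≤ K_C ‖e(0)‖ ‖e(j)‖` where `e(j) = u* − u(j)`. -/
theorem chord_iteration_linear_convergence
    (n : ℕ)
    (F : EuclideanSpace ℝ (Fin n) → EuclideanSpace ℝ (Fin n))
    (F' : EuclideanSpace ℝ (Fin n) →
      (EuclideanSpace ℝ (Fin n) →L[ℝ] EuclideanSpace ℝ (Fin n)))
    (hF : ∀ u, HasFDerivAt F (F' u) u)
    (γ : NNReal) (hLip : LipschitzWith γ F')
    (ustar : EuclideanSpace ℝ (Fin n))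
    (hroot : F ustar = 0)
    (hinv : IsUnit (F' ustar)) :
    ∃ K δ : ℝ, 0 < K ∧ 0 < δ ∧
      ∀ u0 : EuclideanSpace ℝ (Fin n), ‖u0 - ustar‖ < δ →
        IsUnit (F' u0) ∧
        ∀ useq : ℕ → EuclideanSpace ℝ (Fin n),
          useq 0 = u0 →
          (∀ j, useq (j + 1) = useq j - Ring.inverse (F' u0) (F (useq j))) →
          (∀ j, ‖useq j - ustar‖ < δ) ∧
          Filter.Tendsto useq Filter.atTop (nhds ustar) ∧
          (∀ j, ‖ustar - useq (j + 1)‖ ≤ K * ‖ustar - useq 0‖ * ‖ustar - useq j‖) := by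
  set M := ‖Ring.inverse (F' ustar)‖ + 1
  have hnear : ∀ᶠ u in nhds ustar, IsUnit (F' u) ∧ ‖Ring.inverse (F' u)‖ < M := by
    obtain ⟨A, hA⟩ := hinv
    have hcont : ContinuousAt F' ustar := hLip.continuous.continuousAt
    have hinverse : ContinuousAt Ring.inverse (F' ustar) :=
      hA ▸ NormedRing.inverse_continuousAt A
    have hinvcont : ContinuousAt (fun u => Ring.inverse (F' u)) ustar :=
      hinverse.comp hcont
    exact (hcont.eventually (hA ▸ Units.nhds A)).and
      (hinvcont.norm.eventually_lt_const (lt_add_one _))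
  obtain ⟨ε, hε, hball⟩ := Metric.eventually_nhds_iff.1 hnear
  have hMpos : 0 < M := by positivity
  set K : ℝ := M * (2 * γ) + 1 with hK
  have hKpos : 0 < K := by positivity
  refine ⟨K, min ε (1 / (2 * K)), hKpos, by positivity, fun u0 hu0 => ?_⟩
  obtain ⟨hunit, hinvM⟩ := hball (dist_eq_norm u0 ustar ▸ hu0.trans_le (min_le_left _ _))
  refine ⟨hunit, fun useq h0 hrec => ?_⟩
  have hstep : ∀ j, ‖useq j - ustar‖ ≤ ‖u0 - ustar‖ →
      ‖useq (j + 1) - ustar‖ ≤ K * ‖u0 - ustar‖ * ‖useq j - ustar‖ := by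
    intro j hj
    rw [hrec j]
    refine (norm_chord_step_sub_root_le hF hLip hroot hunit hj).trans ?_
    refine mul_le_mul_of_nonneg_right ?_ (norm_nonneg _)
    calc ‖Ring.inverse (F' u0)‖ * (2 * γ * ‖u0 - ustar‖)
        ≤ M * (2 * γ * ‖u0 - ustar‖) := by gcongr
      _ ≤ K * ‖u0 - ustar‖ := by
        rw [hK]
        linarith [norm_nonneg (u0 - ustar)]
  have hhalf : K * ‖u0 - ustar‖ ≤ 1 / 2 := by
    calc K * ‖u0 - ustar‖ ≤ K * (1 / (2 * K)) := by
          gcongr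
          exact hu0.le.trans (min_le_right _ _)
      _ = 1 / 2 := by field_simp
  have hpow : ∀ j : ℕ, (1 / 2) ^ j * ‖u0 - ustar‖ ≤ ‖u0 - ustar‖ := fun j =>
    mul_le_of_le_one_left (norm_nonneg _) (pow_le_one₀ (by norm_num) (by norm_num))
  have hgeom : ∀ j, ‖useq j - ustar‖ ≤ (1 / 2) ^ j * ‖u0 - ustar‖ := by
    intro j
    induction j with
    | zero => simp [h0]
    | succ j ih =>
      calc ‖useq (j + 1) - ustar‖ ≤ K * ‖u0 - ustar‖ * ‖useq j - ustar‖ := hstep j (ih.trans (hpow j))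
        _ ≤ 1 / 2 * ((1 / 2) ^ j * ‖u0 - ustar‖) := by gcongr
        _ = (1 / 2) ^ (j + 1) * ‖u0 - ustar‖ := by ring
  have hle : ∀ j, ‖useq j - ustar‖ ≤ ‖u0 - ustar‖ := fun j =>
    (hgeom j).trans (hpow j)
  refine ⟨fun j => (hle j).trans_lt hu0, ?_, fun j => ?_⟩
  · rw [tendsto_iff_norm_sub_tendsto_zero]
    refine squeeze_zero (fun _ => norm_nonneg _) hgeom ?_
    simpa using (tendsto_pow_atTop_nhds_zero_of_lt_one (r := (1 / 2 : ℝ))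
      (by norm_num) (by norm_num)).mul_const ‖u0 - ustar‖
  · rw [norm_sub_rev ustar, norm_sub_rev ustar, norm_sub_rev ustar, h0]
    exact hstep j (hle j)
end

section
/- For i = 1, …, N, let X_i ∈ ℝ^{n×T_i} have singular value decomposition X_i = V_i Λ_i W_iᵀ with V_i ∈ V_{n,r_i}, W_i ∈ V_{T_i,r_i}, and Λ_i = diag(λ_1(i), …, λ_{r_i}(i)) with λ_1(i) ≥ … ≥ λ_{r_i}(i) > 0. For each i fix k_i ≤ r_i, let Φ_i ∈ ℝ^{n×k_i} be the first k_i columns of V_i, let Λ_i' be the top-left k_i×k_i block of Λ_i, and set E_i = ‖(I − Φ_i Φ_iᵀ)X_i‖_F. Let a_1, …, a_N be real weights, and define the weighted snapshot matrix X^A = [a_1 X_1, …, a_N X_N] and the information matrix X' = [a_1 Φ_1 Λ_1', …, a_N Φ_N Λ_N']. Then for any Φ ∈ V_{n,k'}, setting E_0 = ‖(I − Φ Φᵀ)X'‖_F, one has ‖(I − Φ Φᵀ)X^A‖_F ≤ E_0 + sqrt( Σ_{i=1}^{N} a_i² E_i² ). -/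
open Matrix

/-- Frobenius norm of a real matrix. -/
noncomputable def frobNorm {m p : Type*} [Fintype m] [Fintype p]
    (M : Matrix m p ℝ) : ℝ :=
  Real.sqrt (∑ i, ∑ j, (M i j) ^ 2)

section FrobNorm

variable {m p q : Type*} [Fintype m] [Fintype p] [Fintype q]

theorem frobNorm_nonneg (M : Matrix m p ℝ) : 0 ≤ frobNorm M := Real.sqrt_nonneg _

theorem frobNorm_sq (M : Matrix m p ℝ) : frobNorm M ^ 2 = ∑ i, ∑ j, M i j ^ 2 :=
  Real.sq_sqrt (by positivity)

theorem frobNorm_sq_eq_trace (M : Matrix m p ℝ) : frobNorm M ^ 2 = (Mᵀ * M).trace := by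
  rw [frobNorm_sq, Finset.sum_comm]
  simp [Matrix.trace, Matrix.mul_apply, sq]

attribute [local instance] Matrix.frobeniusNormedAddCommGroup in
theorem frobNorm_add_le (A B : Matrix m p ℝ) :
    frobNorm (A + B) ≤ frobNorm A + frobNorm B := by
  have h (M : Matrix m p ℝ) : frobNorm M = ‖M‖ := by
    simp [frobNorm, Matrix.frobenius_norm_def, Real.sqrt_eq_rpow]
  simpa only [h] using norm_add_le A B

theorem frobNorm_smul_sq (c : ℝ) (M : Matrix m p ℝ) :
    frobNorm (c • M) ^ 2 = c ^ 2 * frobNorm M ^ 2 := by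
  simp [frobNorm_sq, mul_pow, Finset.mul_sum]

theorem frobNorm_mul_transpose_sq [DecidableEq q] (M : Matrix m q ℝ) {W : Matrix p q ℝ}
    (hW : Wᵀ * W = 1) : frobNorm (M * Wᵀ) ^ 2 = frobNorm M ^ 2 := by
  rw [frobNorm_sq_eq_trace, frobNorm_sq_eq_trace, Matrix.transpose_mul, Matrix.transpose_transpose,
    Matrix.mul_assoc, Matrix.trace_mul_comm, Matrix.mul_assoc, Matrix.mul_assoc, hW, Matrix.mul_one]

theorem frobNorm_one_sub_mul_le [DecidableEq m] [DecidableEq q] {Φ : Matrix m q ℝ}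
    (hΦ : Φᵀ * Φ = 1) (M : Matrix m p ℝ) :
    frobNorm ((1 - Φ * Φᵀ) * M) ≤ frobNorm M := by
  have hidem : (1 - Φ * Φᵀ)ᵀ * (1 - Φ * Φᵀ) = 1 - Φ * Φᵀ := by
    have h : Φ * Φᵀ * (Φ * Φᵀ) = Φ * Φᵀ := by
      rw [Matrix.mul_assoc, ← Matrix.mul_assoc Φᵀ, hΦ, Matrix.one_mul]
    simp [Matrix.mul_sub, Matrix.sub_mul, h]
  have key : frobNorm ((1 - Φ * Φᵀ) * M) ^ 2 = frobNorm M ^ 2 - frobNorm (Φᵀ * M) ^ 2 := by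
    simp only [frobNorm_sq_eq_trace]
    rw [← Matrix.trace_sub, Matrix.transpose_mul, Matrix.mul_assoc, ← Matrix.mul_assoc _ _ M, hidem]
    simp [Matrix.sub_mul, Matrix.mul_sub, Matrix.mul_assoc]
  refine le_of_sq_le_sq ?_ (frobNorm_nonneg M)
  linarith [sq_nonneg (frobNorm (Φᵀ * M))]

theorem frobNorm_sq_eq_sum_blocks {ι : Type*} [Fintype ι] {κ : ι → Type*} [∀ i, Fintype (κ i)]
    (M : Matrix m ((i : ι) × κ i) ℝ) :
    frobNorm M ^ 2 = ∑ i, frobNorm (M.submatrix id (Sigma.mk i)) ^ 2 := by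
  simp only [frobNorm_sq, Fintype.sum_sigma, Matrix.submatrix_apply, id]
  exact Finset.sum_comm

end FrobNorm

/-- Projecting `V * diagonal d * Wᵀ` onto the span of a subfamily of the orthonormal columns of `V`
truncates the decomposition to the corresponding indices. -/
theorem proj_submatrix_mul_svd {m p q s : Type*} [Fintype m] [Fintype q] [Fintype s]
    [DecidableEq q] [DecidableEq s] {V : Matrix m q ℝ} (hV : Vᵀ * V = 1) (d : q → ℝ)
    (W : Matrix p q ℝ) (f : s → q) :
    V.submatrix id f * (V.submatrix id f)ᵀ * (V * Matrix.diagonal d * Wᵀ) =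
      V.submatrix id f * Matrix.diagonal (d ∘ f) * (W.submatrix id f)ᵀ := by
  have h : (V.submatrix id f)ᵀ * (V * Matrix.diagonal d * Wᵀ) =
      (Vᵀ * V * (Matrix.diagonal d * Wᵀ)).submatrix f id := by
    rw [Matrix.mul_assoc V, Matrix.mul_assoc Vᵀ]
    rfl
  rw [Matrix.mul_assoc, h, hV, Matrix.one_mul, Matrix.mul_assoc]
  congr 1
  ext i j
  simp [Matrix.diagonal_mul]

/-- for snapshot matrices `X_i = V_i Λ_i W_iᵀ` with truncated POD
bases `Φ_i` (first `k_i` left singular vectors) and truncation errors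
`E_i = ‖(I − Φ_i Φ_iᵀ)X_i‖_F`, weights `a_i`, the weighted snapshot matrix
`X^A = [a_1 X_1, …, a_N X_N]` and the information matrix
`X' = [a_1 Φ_1 Λ_1', …, a_N Φ_N Λ_N']` satisfy, for every `Φ` with orthonormal
columns, `‖(I − ΦΦᵀ)X^A‖_F ≤ ‖(I − ΦΦᵀ)X'‖_F + sqrt(∑ a_i² E_i²)`. -/
theorem information_matrix_projection_error_bound
    (n N k' : ℕ) (T r kk : Fin N → ℕ)
    (X : (i : Fin N) → Matrix (Fin n) (Fin (T i)) ℝ)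
    (V : (i : Fin N) → Matrix (Fin n) (Fin (r i)) ℝ)
    (W : (i : Fin N) → Matrix (Fin (T i)) (Fin (r i)) ℝ)
    (lam : (i : Fin N) → Fin (r i) → ℝ)
    (hV : ∀ i, (V i)ᵀ * V i = 1) (hW : ∀ i, (W i)ᵀ * W i = 1)
    (hpos : ∀ i j, 0 < lam i j)
    (hmono : ∀ i, ∀ j1 j2 : Fin (r i), j1 ≤ j2 → lam i j2 ≤ lam i j1)
    (hSVD : ∀ i, X i = V i * Matrix.diagonal (lam i) * (W i)ᵀ)
    (hk : ∀ i, kk i ≤ r i)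
    (Φs : (i : Fin N) → Matrix (Fin n) (Fin (kk i)) ℝ)
    (hΦs : ∀ i, Φs i = (V i).submatrix id (Fin.castLE (hk i)))
    (E : Fin N → ℝ)
    (hE : ∀ i, E i = frobNorm ((1 - Φs i * (Φs i)ᵀ) * X i))
    (a : Fin N → ℝ)
    (XA : Matrix (Fin n) ((i : Fin N) × Fin (T i)) ℝ)
    (hXA : ∀ x (i : Fin N) (j : Fin (T i)), XA x ⟨i, j⟩ = a i * X i x j)
    (X' : Matrix (Fin n) ((i : Fin N) × Fin (kk i)) ℝ)
    (hX' : ∀ x (i : Fin N) (j : Fin (kk i)), X' x ⟨i, j⟩ =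
      a i * (Φs i *
        Matrix.diagonal (fun j' : Fin (kk i) => lam i (Fin.castLE (hk i) j'))) x j)
    (Φ : Matrix (Fin n) (Fin k') ℝ) (hΦ : Φᵀ * Φ = 1) :
    frobNorm ((1 - Φ * Φᵀ) * XA) ≤
      frobNorm ((1 - Φ * Φᵀ) * X') + Real.sqrt (∑ i, (a i) ^ 2 * (E i) ^ 2) := by
  set P := 1 - Φ * Φᵀ
  let Y : Matrix (Fin n) ((i : Fin N) × Fin (T i)) ℝ :=
    Matrix.of fun x j => a j.1 * (Φs j.1 * (Φs j.1)ᵀ * X j.1) x j.2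
  have hXA_block (i) : XA.submatrix id (Sigma.mk i) = a i • X i := by
    ext x j
    simp [hXA]
  have hX'_block (i) : X'.submatrix id (Sigma.mk i) =
      a i • (Φs i * Matrix.diagonal (lam i ∘ Fin.castLE (hk i))) := by
    ext x j
    simp only [Matrix.submatrix_apply, id, hX', Matrix.smul_apply, smul_eq_mul]
    rfl
  have hY_block (i) : Y.submatrix id (Sigma.mk i) = a i • (Φs i * (Φs i)ᵀ * X i) := rfl
  have hmul {κ : Fin N → Type} [∀ i, Fintype (κ i)] (M : Matrix (Fin n) ((i : Fin N) × κ i) ℝ)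
      (i) : (P * M).submatrix id (Sigma.mk i) = P * M.submatrix id (Sigma.mk i) := rfl
  have hPY : frobNorm (P * Y) = frobNorm (P * X') := by
    refine (sq_eq_sq₀ (frobNorm_nonneg _) (frobNorm_nonneg _)).1 ?_
    rw [frobNorm_sq_eq_sum_blocks, frobNorm_sq_eq_sum_blocks]
    refine Finset.sum_congr rfl fun i _ => ?_
    have hW' : ((W i).submatrix id (Fin.castLE (hk i)))ᵀ *
        (W i).submatrix id (Fin.castLE (hk i)) = 1 := by
      rw [← Matrix.submatrix_one _ (Fin.castLE_injective (hk i)), ← hW i]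
      rfl
    rw [hmul, hmul, hY_block, hX'_block, hSVD, hΦs, proj_submatrix_mul_svd (hV i),
      Matrix.mul_smul, Matrix.mul_smul, frobNorm_smul_sq, frobNorm_smul_sq, ← Matrix.mul_assoc,
      frobNorm_mul_transpose_sq _ hW']
  have hR : frobNorm (XA - Y) = Real.sqrt (∑ i, a i ^ 2 * E i ^ 2) := by
    rw [← Real.sqrt_sq (frobNorm_nonneg (XA - Y)), frobNorm_sq_eq_sum_blocks]
    congr 1
    refine Finset.sum_congr rfl fun i _ => ?_
    rw [Matrix.submatrix_sub, Pi.sub_apply, Pi.sub_apply, hXA_block, hY_block, ← smul_sub,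
      frobNorm_smul_sq, hE, Matrix.sub_mul, Matrix.one_mul]
  calc frobNorm (P * XA) = frobNorm (P * Y + P * (XA - Y)) := by
        rw [← Matrix.mul_add, add_sub_cancel]
    _ ≤ frobNorm (P * Y) + frobNorm (P * (XA - Y)) := frobNorm_add_le _ _
    _ ≤ _ := by
      rw [hPY, ← hR]
      gcongr
      exact frobNorm_one_sub_mul_le hΦ _
end
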